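/- arXiv:1208.3075 — 3 statements merged into one kernel-verified Lean document; each statement's English description precedes it below -/
import Mathlib

section
/- Let G be a group, φ an injective endomorphism of G, H = Gφ, and K a non-identity subgroup of G such that the subgroup L generated by H and K is their internal free product H ∗ K. Then for every integer r ≥ 1, the subgroup M_r of G generated by the subgroups Kφ⁰ = K, Kφ, …, Kφʳ is the internal free product of these subgroups. -/
/-- A group has the Howson property if the intersection of any two finitely
generated subgroups is finitely generated. -/
def HowsonGroup (G : Type*) [Group G] : Prop :=
  ∀ H K : Subgroup G, H.FG → K.FG → (H ⊓ K).FG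

/-- The descending HNN-extension `G(φ) = ⟨G, t ; t⁻¹ g t = gφ (g ∈ G)⟩` of a group `G`
with respect to an injective endomorphism `φ`, realized as the Mathlib `HNNExtension`
with base `G`, associated subgroups `φ.range` and `G` (i.e. `⊤`), so that the relation
`t⁻¹ * of g * t = of (φ g)` holds for all `g : G`. -/
abbrev DescHNN {G : Type*} [Group G] (φ : G →* G) (hφ : Function.Injective φ) : Type _ :=
  HNNExtension G (MonoidHom.range φ) ⊤
    ((MonoidHom.ofInjective hφ).symm.trans Subgroup.topEquiv.symm)

/-- The subgroup generated by subgroups `H` and `K` of a group `G` is their internal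
free product `H ∗ K`: the canonical homomorphism from the abstract free product
`H ∗ K` to `G` (whose range is `⟨H, K⟩ = H ⊔ K`) is injective. -/
def IsInternalFreeProductPair {G : Type*} [Group G] (H K : Subgroup G) : Prop :=
  Function.Injective (Monoid.Coprod.lift H.subtype K.subtype)

/-- A subgroup `H` of a group `G` is freely complemented if there is a non-identity
subgroup `K` of `G` such that the subgroup generated by `H` and `K` is their
internal free product `H ∗ K`. -/
def FreelyComplemented {G : Type*} [Group G] (H : Subgroup G) : Prop :=
  ∃ K : Subgroup G, K ≠ ⊥ ∧ IsInternalFreeProductPair H K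

namespace Monoid.CoprodI

/-- Free products of injective homomorphisms are injective. -/
theorem lift_of_comp_injective {ι : Type*} {M N : ι → Type*} [∀ i, Monoid (M i)]
    [∀ i, Monoid (N i)] (f : ∀ i, M i →* N i) (hf : ∀ i, Function.Injective (f i)) :
    Function.Injective (lift fun i => (of : N i →* CoprodI N).comp (f i)) := by
  classical
  let F : (Σ i, M i) → Σ i, N i := Sigma.map id fun i => f i
  let W : Word M → Word N := fun w =>
    { toList := w.toList.map F
      ne_one := by
        intro l hl
        obtain ⟨a, ha, rfl⟩ := List.mem_map.1 hl
        exact fun h => w.ne_one a ha (hf _ (h.trans (map_one _).symm))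
      chain_ne := (List.isChain_map F).2 w.chain_ne }
  have hF : Function.Injective F := Function.injective_id.sigma_map hf
  have hW : Function.Injective W := fun w₁ w₂ h =>
    Word.ext (List.map_injective_iff.2 hF (congrArg Word.toList h))
  have hprod (w : Word M) :
      lift (fun i => (of : N i →* CoprodI N).comp (f i)) w.prod = (W w).prod := by
    simp only [Word.prod, map_list_prod, List.map_map, W]
    rfl
  intro x y hxy
  obtain ⟨v, rfl⟩ := Word.equiv.symm.surjective x
  obtain ⟨w, rfl⟩ := Word.equiv.symm.surjective y
  have h : Word.equiv.symm (W v) = Word.equiv.symm (W w) :=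
    (hprod v).symm.trans (hxy.trans (hprod w))
  rw [hW (Word.equiv.symm.injective h)]

end Monoid.CoprodI

open Monoid

theorem IsInternalFreeProductPair.injective_lift_cond {G : Type*} [Group G] {H K : Subgroup G}
    (h : IsInternalFreeProductPair H K) :
    Function.Injective (CoprodI.lift fun b : Bool => (cond b H K).subtype) := by
  let e : CoprodI (fun b : Bool => ↥(cond b H K)) →* Coprod H K := CoprodI.lift fun b =>
    match b with
    | true => Coprod.inl
    | false => Coprod.inr
  let g : Coprod H K →* CoprodI (fun b : Bool => ↥(cond b H K)) :=
    Coprod.lift (CoprodI.of (M := fun b : Bool => ↥(cond b H K)) (i := true))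
      (CoprodI.of (M := fun b : Bool => ↥(cond b H K)) (i := false))
  have hge : g.comp e = MonoidHom.id _ := by
    refine CoprodI.ext_hom _ _ fun b => ?_
    cases b <;> ext x <;> simp [g, e]
  have he : Function.Injective e := Function.LeftInverse.injective (DFunLike.congr_fun hge)
  have hfac : (CoprodI.lift fun b : Bool => (cond b H K).subtype) =
      (Coprod.lift H.subtype K.subtype).comp e := by
    refine CoprodI.ext_hom _ _ fun b => ?_
    cases b <;> ext x <;> simp [e]
  rw [hfac]
  exact Function.Injective.comp (g := Coprod.lift H.subtype K.subtype) h he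

/-- Passing to smaller factors preserves internal free products. -/
theorem Subgroup.injective_coprodI_lift_mono {G ι : Type*} [Group G] {T S : ι → Subgroup G}
    (hTS : ∀ i, T i ≤ S i) (hS : Function.Injective (CoprodI.lift fun i => (S i).subtype)) :
    Function.Injective (CoprodI.lift fun i => (T i).subtype) := by
  have hfac : (CoprodI.lift fun i => (T i).subtype) =
      (CoprodI.lift fun i => (S i).subtype).comp
        (CoprodI.lift fun i => CoprodI.of.comp (Subgroup.inclusion (hTS i))) := by
    refine CoprodI.ext_hom _ _ fun i => ?_
    ext x
    simp
  rw [hfac]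
  exact hS.comp (CoprodI.lift_of_comp_injective _ fun i => Subgroup.inclusion_injective (hTS i))

theorem IsInternalFreeProductPair.injective_lift_pow_comp {G : Type*} [Group G]
    {φ : Monoid.End G} (hφ : Function.Injective φ) {K : Subgroup G}
    (hfp : IsInternalFreeProductPair (MonoidHom.range (φ : G →* G)) K) (n : ℕ) :
    Function.Injective
      (CoprodI.lift fun i : Fin n => ((φ ^ (i : ℕ) : Monoid.End G) : G →* G).comp K.subtype) := by
  induction n with
  | zero =>
    intro x y _
    have h : MonoidHom.id (CoprodI fun _ : Fin 0 => K) = 1 :=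
      CoprodI.ext_hom _ _ fun i => i.elim0
    exact (DFunLike.congr_fun h x).trans (DFunLike.congr_fun h y).symm
  | succ n ih =>
    let f : CoprodI (fun _ : Fin n => K) →* G := (φ : G →* G).comp
      (CoprodI.lift fun i : Fin n => ((φ ^ (i : ℕ) : Monoid.End G) : G →* G).comp K.subtype)
    have hf : Function.Injective f := fun _ _ h => ih (hφ h)
    have hle (b : Bool) : cond b f.range K ≤ cond b (MonoidHom.range (φ : G →* G)) K := by
      cases b
      · exact le_rfl
      · rintro _ ⟨x, rfl⟩
        exact ⟨_, rfl⟩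
    let e : CoprodI (fun _ : Fin (n + 1) => K) →* CoprodI (fun b : Bool => ↥(cond b f.range K)) :=
      CoprodI.lift <| Fin.cases (CoprodI.of (M := fun b : Bool => ↥(cond b f.range K)) (i := false))
        fun i => (CoprodI.of (M := fun b : Bool => ↥(cond b f.range K)) (i := true)).comp (f.rangeRestrict.comp
          (CoprodI.of (M := fun _ : Fin n => K) (i := i)))
    let g : CoprodI (fun b : Bool => ↥(cond b f.range K)) →* CoprodI (fun _ : Fin (n + 1) => K) :=
      CoprodI.lift fun b =>
        match b with
        | true => (CoprodI.lift fun i : Fin n =>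
            CoprodI.of (M := fun _ : Fin (n + 1) => K) (i := i.succ)).comp
            (MonoidHom.ofInjective hf).symm.toMonoidHom
        | false => CoprodI.of (M := fun _ : Fin (n + 1) => K) (i := 0)
    have hge : g.comp e = MonoidHom.id _ := by
      refine CoprodI.ext_hom _ _ fun i => ?_
      cases i using Fin.cases with
      | zero => ext x; simp [g, e]
      | succ i =>
        ext x
        have hx : (MonoidHom.ofInjective hf).symm (f.rangeRestrict (CoprodI.of (M := fun _ : Fin n => K) (i := i) x)) =
            CoprodI.of (M := fun _ : Fin n => K) (i := i) x := (MonoidHom.ofInjective hf).symm_apply_apply _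
        simp [g, e, hx]
    have he : Function.Injective e := Function.LeftInverse.injective (DFunLike.congr_fun hge)
    have hfac : (CoprodI.lift fun i : Fin (n + 1) =>
          ((φ ^ (i : ℕ) : Monoid.End G) : G →* G).comp K.subtype) =
        (CoprodI.lift fun b : Bool => (cond b f.range K).subtype).comp e := by
      refine CoprodI.ext_hom _ _ fun i => ?_
      cases i using Fin.cases with
      | zero => ext x; rfl
      | succ i =>
        ext x
        exact DFunLike.congr_fun (pow_succ' φ (i : ℕ)) (x : G)
    rw [hfac]
    exact (Subgroup.injective_coprodI_lift_mono hle hfp.injective_lift_cond).comp he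

/-- Let `G` be a group, `φ` an injective endomorphism of `G`, `H = Gφ`, and `K` a
non-identity subgroup of `G` such that the subgroup generated by `H` and `K` is their
internal free product `H ∗ K`. Then for every `r ≥ 1`, the subgroup `M_r` of `G`
generated by the subgroups `Kφ⁰ = K, Kφ, …, Kφʳ` is the internal free product of these
subgroups: the canonical homomorphism from their abstract free product is injective, and
its range is `M_r`. -/
theorem subgroup_Mr_is_free_product {G : Type*} [Group G]
    (φ : Monoid.End G) (hφ : Function.Injective φ)
    (K : Subgroup G) (hK : K ≠ ⊥)
    (hfp : IsInternalFreeProductPair (MonoidHom.range (φ : G →* G)) K)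
    (r : ℕ) (hr : 1 ≤ r) :
    Function.Injective
      (Monoid.CoprodI.lift fun i : Fin (r + 1) => (K.map (φ ^ (i : ℕ))).subtype) ∧
      MonoidHom.range
          (Monoid.CoprodI.lift fun i : Fin (r + 1) => (K.map (φ ^ (i : ℕ))).subtype)
        = ⨆ i : Fin (r + 1), K.map (φ ^ (i : ℕ)) := by
  refine ⟨?_, by simp [CoprodI.range_eq_iSup]⟩
  have hpow (i : ℕ) : Function.Injective (φ ^ i) := by
    rw [Monoid.End.coe_pow]
    exact hφ.iterate i
  let ψ (i : Fin (r + 1)) : K.map (φ ^ (i : ℕ)) →* K :=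
    (K.equivMapOfInjective (φ ^ (i : ℕ)) (hpow i)).symm.toMonoidHom
  have hfac : (CoprodI.lift fun i : Fin (r + 1) => (K.map (φ ^ (i : ℕ))).subtype) =
      (CoprodI.lift fun i : Fin (r + 1) =>
        ((φ ^ (i : ℕ) : Monoid.End G) : G →* G).comp K.subtype).comp
        (CoprodI.lift fun i => (CoprodI.of (M := fun _ : Fin (r + 1) => K) (i := i)).comp (ψ i)) := by
    refine CoprodI.ext_hom _ _ fun i => ?_
    ext x
    obtain ⟨k, rfl⟩ := (K.equivMapOfInjective (φ ^ (i : ℕ)) (hpow i)).surjective x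
    simp [ψ]
    rfl
  rw [hfac]
  exact (hfp.injective_lift_pow_comp hφ (r + 1)).comp
    (CoprodI.lift_of_comp_injective _ fun i =>
      (K.equivMapOfInjective (φ ^ (i : ℕ)) (hpow i)).symm.injective)
end

section
/- (Lemma 2) Let G be a finitely generated group, φ an injective but not surjective endomorphism of G, H = Gφ, and K a non-identity finitely generated subgroup of G such that the subgroup L generated by H and K is their internal free product H ∗ K. In the descending HNN-extension G(φ) set Kₙ = t⁻ⁿKtⁿ for n ∈ ℤ, let N be the subgroup generated by all Kₙ (n ∈ ℤ) and M the subgroup generated by all Kₙ with n ≥ 0. Then N ∩ G = M, where G is identified with its canonical image in G(φ). -/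
/-- If `⟨H, K⟩ = H ∗ K` and `A ≤ H`, then `⟨A, K⟩ ∩ H = A`: the retraction of `H ∗ K` onto `H`
that kills `K` maps `⟨A, K⟩` into `A`. -/
theorem IsInternalFreeProductPair.sup_inf_le {G : Type*} [Group G] {H K A : Subgroup G}
    (h : IsInternalFreeProductPair H K) (hA : A ≤ H) : (A ⊔ K) ⊓ H ≤ A := by
  rintro y ⟨hy, hyH⟩
  let S : Subgroup (Monoid.Coprod H K) :=
    (A.subgroupOf H).map Monoid.Coprod.inl ⊔ (Monoid.Coprod.inr : K →* Monoid.Coprod H K).range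
  have hS : S.map (Monoid.Coprod.lift H.subtype K.subtype) = A ⊔ K := by
    rw [Subgroup.map_sup, Subgroup.map_map, MonoidHom.map_range, Monoid.Coprod.lift_comp_inl,
      Monoid.Coprod.lift_comp_inr, Subgroup.map_subgroupOf_eq_of_le hA, Subgroup.range_subtype]
  have hfst : S.map Monoid.Coprod.fst ≤ A.subgroupOf H := by
    rw [Subgroup.map_sup, Subgroup.map_map, MonoidHom.map_range, Monoid.Coprod.fst_comp_inl,
      Monoid.Coprod.fst_comp_inr]
    simp
  rw [← hS] at hy
  obtain ⟨s, hs, hsy⟩ := hy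
  have hinl : s = Monoid.Coprod.inl ⟨y, hyH⟩ := h (by simpa using hsy)
  have hmem := hfst (Subgroup.mem_map_of_mem Monoid.Coprod.fst hs)
  rwa [hinl, Monoid.Coprod.fst_apply_inl, Subgroup.mem_subgroupOf] at hmem

/-- A version of `IsInternalFreeProductPair.sup_inf_le` in an overgroup. -/
theorem IsInternalFreeProductPair.map_sup_inf_le {G E : Type*} [Group G] [Group E]
    {H K : Subgroup G} (h : IsInternalFreeProductPair H K) {f : G →* E}
    (hf : Function.Injective f) {A : Subgroup E} (hA : A ≤ H.map f) :
    (A ⊔ K.map f) ⊓ H.map f ≤ A := by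
  have hmap : (A.comap f).map f = A :=
    Subgroup.map_comap_eq_self (hA.trans (Subgroup.map_le_range f H))
  have hle : A.comap f ≤ H := by
    rwa [← Subgroup.map_le_map_iff_of_injective hf, hmap]
  have := Subgroup.map_mono (f := f) (h.sup_inf_le hle)
  rwa [Subgroup.map_inf _ _ _ hf, Subgroup.map_sup, hmap] at this

/-- The defining relation `t⁻¹ g t = gφ` of a descending HNN-extension. -/
theorem DescHNN.conj_of {G : Type*} [Group G] (φ : G →* G) (hφ : Function.Injective φ) (g : G) :
    MulAut.conj (HNNExtension.t⁻¹ : DescHNN φ hφ) (HNNExtension.of g) =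
      HNNExtension.of (φ g) := by
  have h := HNNExtension.t_mul_of (φ := (MonoidHom.ofInjective hφ).symm.trans
    Subgroup.topEquiv.symm) (MonoidHom.ofInjective hφ g)
  rw [MulAut.conj_apply, inv_inv, mul_assoc, inv_mul_eq_iff_eq_mul]
  have hcoe : ((MonoidHom.ofInjective hφ g : φ.range) : G) = φ g := rfl
  simpa [hcoe] using h.symm

/-- **Lemma 2.** Let `G` be a finitely generated group, `φ` an injective but not
surjective endomorphism of `G`, `H = Gφ`, and `K` a non-identity finitely generated
subgroup of `G` such that the subgroup generated by `H` and `K` is their internal free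
product. In `G(φ)` set `Kₙ = t⁻ⁿKtⁿ`, let `N` be the subgroup generated by all `Kₙ`
(`n ∈ ℤ`) and `M` the subgroup generated by all `Kₙ` with `n ≥ 0`. Then `N ∩ G = M`,
where `G` is identified with its canonical image in `G(φ)`. -/
theorem subgroup_N_inter_G_eq_M {G : Type*} [Group G] [Group.FG G]
    (φ : G →* G) (hφ : Function.Injective φ) (hns : ¬ Function.Surjective φ)
    (K : Subgroup G) (hK : K ≠ ⊥) (hKfg : K.FG)
    (hfp : IsInternalFreeProductPair (MonoidHom.range φ) K)
    (Kn : ℤ → Subgroup (DescHNN φ hφ))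
    (hKn : ∀ n : ℤ, Kn n = (K.map (HNNExtension.of : G →* DescHNN φ hφ)).map
      (MulAut.conj (HNNExtension.t ^ (-n))).toMonoidHom)
    (N M : Subgroup (DescHNN φ hφ))
    (hN : N = ⨆ n : ℤ, Kn n) (hM : M = ⨆ n : ℕ, Kn n) :
    N ⊓ MonoidHom.range (HNNExtension.of : G →* DescHNN φ hφ) = M := by
  subst hN hM
  set M := ⨆ n : ℕ, Kn n
  let c := MulAut.conj (HNNExtension.t⁻¹ : DescHNN φ hφ)
  have hcK (m : ℕ) (n : ℤ) : (Kn n).map (c ^ m).toMonoidHom = Kn (n + m) := by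
    have hconj : MulAut.conj (HNNExtension.t ^ (-(n + m)) : DescHNN φ hφ) =
        c ^ m * MulAut.conj (HNNExtension.t ^ (-n)) := by
      rw [neg_add_rev, zpow_add, map_mul, zpow_neg _ (m : ℤ), zpow_natCast, ← inv_pow, map_pow]
    rw [hKn, hKn, Subgroup.map_map, hconj]
    rfl
  have hsucc (n : ℤ) : (Kn n).map c.toMonoidHom = Kn (n + 1) := by simpa using hcK 1 n
  have hK0 : Kn 0 = K.map HNNExtension.of := by
    rw [hKn, neg_zero, zpow_zero, map_one]
    exact Subgroup.map_id _
  have hrange : (HNNExtension.of : G →* DescHNN φ hφ).range.map c.toMonoidHom =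
      φ.range.map HNNExtension.of := by
    rw [MonoidHom.map_range, MonoidHom.map_range]
    exact congrArg MonoidHom.range (MonoidHom.ext (DescHNN.conj_of φ hφ))
  have hM_range : M ≤ (HNNExtension.of : G →* DescHNN φ hφ).range := by
    refine iSup_le fun n ↦ ?_
    induction n with
    | zero => simpa [hK0] using Subgroup.map_le_range _ K
    | succ n ih =>
      rw [Nat.cast_succ, ← hsucc]
      exact (Subgroup.map_mono ih).trans (hrange.trans_le (Subgroup.map_le_range _ _))
  have hM_eq : M = M.map c.toMonoidHom ⊔ K.map HNNExtension.of := by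
    rw [Subgroup.map_iSup, sup_comm, ← hK0]
    simp only [hsucc]
    exact_mod_cast (sup_iSup_nat_succ fun n : ℕ ↦ Kn n).symm
  have hcM (x) (hx : x ∈ M) : c x ∈ M := by
    rw [hM_eq]
    exact Subgroup.mem_sup_left (Subgroup.mem_map_of_mem _ hx)
  have hcM_pow (m : ℕ) (x) (hx : x ∈ M) : (c ^ m) x ∈ M := by
    induction m with
    | zero => exact hx
    | succ m ih => rw [pow_succ']; exact hcM _ ih
  have hof_pow (m : ℕ) (x) (hx : x ∈ (HNNExtension.of : G →* DescHNN φ hφ).range)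
      (hxM : (c ^ m) x ∈ M) : x ∈ M := by
    induction m generalizing x with
    | zero => exact hxM
    | succ m ih =>
      have hcx : c x ∈ φ.range.map HNNExtension.of := hrange ▸ Subgroup.mem_map_of_mem _ hx
      have hcxM : c x ∈ M := ih _ (Subgroup.map_le_range _ _ hcx) hxM
      have hle := hfp.map_sup_inf_le (HNNExtension.of_injective _)
        (hrange ▸ Subgroup.map_mono hM_range)
      rw [← hM_eq] at hle
      exact (Subgroup.mem_map_iff_mem c.injective).1 (hle ⟨hcxM, hcx⟩)
  refine le_antisymm ?_ (le_inf (iSup_le fun n ↦ le_iSup Kn n) hM_range)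
  rintro x ⟨hxN, hx⟩
  obtain ⟨m, hm⟩ : ∃ m : ℕ, (c ^ m) x ∈ M := by
    clear hx
    induction hxN using Subgroup.iSup_induction' with
    | hp n x hx =>
      have hmem := Subgroup.mem_map_of_mem (c ^ n.natAbs).toMonoidHom hx
      rw [hcK, ← Int.toNat_of_nonneg (show 0 ≤ n + n.natAbs by omega)] at hmem
      exact ⟨n.natAbs, Subgroup.mem_iSup_of_mem _ hmem⟩
    | h1 => exact ⟨0, M.one_mem⟩
    | hmul x y _ _ ihx ihy =>
      obtain ⟨a, ha⟩ := ihx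
      obtain ⟨b, hb⟩ := ihy
      refine ⟨a + b, ?_⟩
      rw [map_mul]
      refine M.mul_mem ?_ ?_
      · rw [add_comm, pow_add]; exact hcM_pow _ _ ha
      · rw [pow_add]; exact hcM_pow _ _ hb
  exact hof_pow m x hx hm
end

section
/- Let G be a finitely generated group, φ an injective but not surjective endomorphism of G, H = Gφ, and K a non-identity finitely generated subgroup of G such that the subgroup L generated by H and K is their internal free product H ∗ K. In the descending HNN-extension G(φ) let F be the subgroup generated by K and the stable letter t, and let M be the subgroup generated by the subgroups Kφⁿ for all n ≥ 0. Then F ∩ G = M, where G is identified with its canonical image in G(φ). -/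
/-- If `⟨H, K⟩ = H ∗ K` is an internal free product and `N ≤ H`, then `H ∩ ⟨K, N⟩ = N`. -/
theorem IsInternalFreeProductPair.mem_of_mem_sup {G : Type*} [Group G] {H K N : Subgroup G}
    (h : IsInternalFreeProductPair H K) (hle : N ≤ H) {x : G} (hxH : x ∈ H)
    (hx : x ∈ K ⊔ N) : x ∈ N := by
  let f : Monoid.Coprod H K →* G := Monoid.Coprod.lift H.subtype K.subtype
  let r : Monoid.Coprod H K →* H := Monoid.Coprod.lift (MonoidHom.id H) 1
  have hsup : K ⊔ N ≤ ((N.subgroupOf H).comap r).map f := by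
    refine sup_le (fun k hk => ?_) fun y hy => ?_
    · exact ⟨Monoid.Coprod.inr ⟨k, hk⟩, by simp [r], by simp [f]⟩
    · exact ⟨Monoid.Coprod.inl ⟨y, hle hy⟩, by simpa [r, Subgroup.mem_subgroupOf] using hy,
        by simp [f]⟩
  obtain ⟨y, hy, hyx⟩ := hsup hx
  obtain rfl : y = Monoid.Coprod.inl ⟨x, hxH⟩ := h (by simpa [f] using hyx)
  simpa [r, Subgroup.mem_subgroupOf] using hy

section

variable {G : Type*} [Group G] (φ : Monoid.End G) (K : Subgroup G)

/-- The subgroup generated by the images of `K` under all powers of `φ`. -/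
def iterateSup : Subgroup G := ⨆ n : ℕ, K.map (φ ^ n : Monoid.End G)

theorem le_iterateSup : K ≤ iterateSup φ K := fun k hk =>
  Subgroup.mem_iSup_of_mem 0 ⟨k, hk, rfl⟩

theorem map_mem_iterateSup {g : G} (hg : g ∈ iterateSup φ K) : φ g ∈ iterateSup φ K := by
  suffices iterateSup φ K ≤ (iterateSup φ K).comap φ from this hg
  refine iSup_le fun n => ?_
  rintro _ ⟨k, hk, rfl⟩
  exact Subgroup.mem_iSup_of_mem (n + 1) ⟨k, hk, by rw [pow_succ']; rfl⟩

theorem pow_map_mem_iterateSup {g : G} (hg : g ∈ iterateSup φ K) (n : ℕ) :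
    (φ ^ n) g ∈ iterateSup φ K := by
  induction n with
  | zero => exact hg
  | succ n ih => rw [pow_succ']; exact map_mem_iterateSup φ K ih

theorem iterateSup_le_sup_map : iterateSup φ K ≤ K ⊔ (iterateSup φ K).map φ := by
  refine iSup_le fun n => ?_
  cases n with
  | zero => exact fun x ⟨k, hk, hkx⟩ => hkx ▸ Subgroup.mem_sup_left hk
  | succ n =>
    rintro _ ⟨k, hk, rfl⟩
    exact Subgroup.mem_sup_right
      ⟨(φ ^ n) k, pow_map_mem_iterateSup φ K (le_iterateSup φ K hk) n, by rw [pow_succ']; rfl⟩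

variable {φ K}

theorem mem_iterateSup_of_map_mem (hφ : Function.Injective φ)
    (hfp : IsInternalFreeProductPair (MonoidHom.range (φ : G →* G)) K) {g : G}
    (hg : φ g ∈ iterateSup φ K) : g ∈ iterateSup φ K := by
  obtain ⟨m, hm, hmg⟩ := hfp.mem_of_mem_sup (Subgroup.map_le_range φ _) ⟨g, rfl⟩
    (iterateSup_le_sup_map φ K hg)
  exact hφ hmg ▸ hm

theorem mem_iterateSup_of_pow_map_mem (hφ : Function.Injective φ)
    (hfp : IsInternalFreeProductPair (MonoidHom.range (φ : G →* G)) K) {g : G} (n : ℕ)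
    (hg : (φ ^ n) g ∈ iterateSup φ K) : g ∈ iterateSup φ K := by
  induction n with
  | zero => exact hg
  | succ n ih =>
    rw [pow_succ'] at hg
    exact ih (mem_iterateSup_of_map_mem hφ hfp hg)

end

namespace DescHNN

open HNNExtension

variable {G : Type*} [Group G] {φ : Monoid.End G} (hφ : Function.Injective φ)

theorem of_mul_t (g : G) :
    (of g : DescHNN (φ : G →* G) hφ) * t = t * of (φ g) :=
  HNNExtension.of_mul_t (⟨g, trivial⟩ : (⊤ : Subgroup G))

theorem of_mul_t_pow (g : G) (n : ℕ) :
    (of g : DescHNN (φ : G →* G) hφ) * t ^ n = t ^ n * of ((φ ^ n) g) := by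
  induction n with
  | zero => simp
  | succ n ih =>
    rw [pow_succ, ← mul_assoc, ih, mul_assoc, of_mul_t, ← mul_assoc, pow_succ' φ]
    rfl

/-- The exponent sum of the stable letter. -/
noncomputable def tExponent : DescHNN (φ : G →* G) hφ →* Multiplicative ℤ :=
  lift 1 (Multiplicative.ofAdd 1) (by simp)

theorem exists_eq_t_pow_mul (K : Subgroup G) {x : DescHNN (φ : G →* G) hφ}
    (hx : x ∈ K.map (of : G →* DescHNN (φ : G →* G) hφ) ⊔ Subgroup.zpowers t) :
    ∃ i j : ℕ, ∃ m ∈ iterateSup φ K, x = t ^ i * of m * (t ^ j)⁻¹ := by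
  rw [Subgroup.zpowers_eq_closure, ← Subgroup.closure_eq (K.map of),
    ← Subgroup.closure_union] at hx
  induction hx using Subgroup.closure_induction_left with
  | one => exact ⟨0, 0, 1, one_mem _, by simp⟩
  | mul_left y hy z _ ih =>
    obtain ⟨i, j, m, hm, rfl⟩ := ih
    rcases hy with ⟨k, hk, rfl⟩ | rfl
    · refine ⟨i, j, (φ ^ i) k * m,
        mul_mem (pow_map_mem_iterateSup φ K (le_iterateSup φ K hk) i) hm, ?_⟩
      simp only [map_mul, ← mul_assoc, of_mul_t_pow]
    · exact ⟨i + 1, j, m, hm, by simp only [pow_succ', mul_assoc]⟩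
  | inv_mul_cancel y hy z _ ih =>
    obtain ⟨i, j, m, hm, rfl⟩ := ih
    rcases hy with ⟨k, hk, rfl⟩ | rfl
    · refine ⟨i, j, (φ ^ i) k⁻¹ * m,
        mul_mem (pow_map_mem_iterateSup φ K (le_iterateSup φ K (inv_mem hk)) i) hm, ?_⟩
      simp only [← map_inv of, map_mul of, ← mul_assoc, of_mul_t_pow]
    · cases i with
      | zero =>
        refine ⟨0, j + 1, φ m, map_mem_iterateSup φ K hm, ?_⟩
        rw [inv_mul_eq_iff_eq_mul, pow_zero, one_mul, one_mul, ← mul_assoc, ← of_mul_t,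
          pow_succ', mul_inv_rev]
        group
      | succ i => exact ⟨i, j, m, hm, by simp only [pow_succ', mul_assoc, inv_mul_cancel_left]⟩

end DescHNN

/-- Let `G` be a finitely generated group, `φ` an injective but not surjective
endomorphism of `G`, `H = Gφ`, and `K` a non-identity finitely generated subgroup of `G`
such that the subgroup generated by `H` and `K` is their internal free product. In `G(φ)`
let `F` be the subgroup generated by `K` and the stable letter `t`, and let `M` be the
subgroup generated by the subgroups `Kφⁿ`, `n ≥ 0`. Then `F ∩ G = M`, where `G` is
identified with its canonical image in `G(φ)`. -/
theorem subgroup_F_inter_G_eq_M {G : Type*} [Group G] [Group.FG G]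
    (φ : Monoid.End G) (hφ : Function.Injective φ) (hns : ¬ Function.Surjective φ)
    (K : Subgroup G) (hK : K ≠ ⊥) (hKfg : K.FG)
    (hfp : IsInternalFreeProductPair (MonoidHom.range (φ : G →* G)) K)
    (F M : Subgroup (DescHNN (φ : G →* G) hφ))
    (hF : F = K.map (HNNExtension.of : G →* DescHNN (φ : G →* G) hφ)
      ⊔ Subgroup.zpowers HNNExtension.t)
    (hM : M = ⨆ n : ℕ, (K.map (φ ^ n)).map
      (HNNExtension.of : G →* DescHNN (φ : G →* G) hφ)) :
    F ⊓ MonoidHom.range (HNNExtension.of : G →* DescHNN (φ : G →* G) hφ) = M := by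
  have hM_eq : M = (iterateSup φ K).map (HNNExtension.of : G →* DescHNN (φ : G →* G) hφ) := by
    rw [hM, iterateSup, Subgroup.map_iSup]
  subst hF
  rw [hM_eq]
  apply le_antisymm
  · rintro _ ⟨hx, g, rfl⟩
    obtain ⟨i, j, m, hm, h⟩ := DescHNN.exists_eq_t_pow_mul hφ K hx
    obtain rfl : i = j := by
      have := congrArg (fun y => (DescHNN.tExponent hφ y).toAdd) h
      simp [DescHNN.tExponent] at this
      omega
    refine ⟨g, mem_iterateSup_of_pow_map_mem hφ hfp i ?_, rfl⟩
    rw [eq_mul_inv_iff_mul_eq, DescHNN.of_mul_t_pow, mul_right_inj] at h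
    exact HNNExtension.of_injective _ h ▸ hm
  · refine le_inf ?_ (Subgroup.map_le_range _ _)
    rw [Subgroup.map_le_iff_le_comap]
    refine iSup_le fun n => ?_
    rintro _ ⟨k, hk, rfl⟩
    have ht : (HNNExtension.t : DescHNN (φ : G →* G) hφ) ^ n ∈
        K.map HNNExtension.of ⊔ Subgroup.zpowers HNNExtension.t :=
      Subgroup.mem_sup_right (pow_mem (Subgroup.mem_zpowers _) n)
    have := mul_mem (inv_mem ht)
      (mul_mem (Subgroup.mem_sup_left (Subgroup.mem_map_of_mem HNNExtension.of hk)) ht)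
    rwa [DescHNN.of_mul_t_pow, inv_mul_cancel_left] at this
end
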